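/- Let G be a graph of order n with adjacency matrix A_G, and let κ, τ be nonnegative integers. Then G has a (κ,τ)-regular set if and only if the linear system (A_G − (κ − τ)I_n)x = τ·𝟙 has a solution x with all entries in {0,1}, where I_n is the identity matrix and 𝟙 the all-ones vector. Furthermore, every 0-1 solution of this system is the characteristic vector of a (κ,τ)-regular set of G. -/

import Mathlib

open SimpleGraph Matrix

/-- `S` is a `(κ,τ)`-regular set of `G`: every vertex in `S` has exactly `κ` neighbors in `S`
and every vertex outside `S` has exactly `τ` neighbors in `S`. -/
def IsKTRegular {V : Type*} (G : SimpleGraph V) (S : Set V) (κ τ : ℕ) : Prop :=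
  (∀ v ∈ S, (G.neighborSet v ∩ S).ncard = κ) ∧ ∀ v ∉ S, (G.neighborSet v ∩ S).ncard = τ

/-- The characteristic (0-1) vector of a vertex subset. -/
noncomputable def charVec {V : Type*} (S : Set V) : V → ℝ := S.indicator 1

/-- `μ` is an eigenvalue of the real matrix `A`. -/
def IsAdjEigenvalue {n : ℕ} (A : Matrix (Fin n) (Fin n) ℝ) (μ : ℝ) : Prop :=
  ∃ v : Fin n → ℝ, v ≠ 0 ∧ A.mulVec v = μ • v

theorem adjMatrix_mulVec_charVec {V : Type*} [Fintype V] (G : SimpleGraph V)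
    [DecidableRel G.Adj] (S : Set V) (v : V) :
    (G.adjMatrix ℝ *ᵥ charVec S) v = (G.neighborSet v ∩ S).ncard := by
  classical
  have h : G.neighborSet v ∩ S = ((G.neighborFinset v).filter (· ∈ S) : Finset V) := by
    ext w
    simp
  rw [adjMatrix_mulVec_apply, h, Set.ncard_coe_finset, Finset.card_filter]
  simp [charVec, Set.indicator_apply]

theorem charVec_eq_zero_or_one {V : Type*} (S : Set V) (v : V) :
    charVec S v = 0 ∨ charVec S v = 1 := by
  by_cases h : v ∈ S <;> simp [charVec, h]

theorem eq_charVec_of_zero_or_one {V : Type*} {x : V → ℝ} (hx : ∀ v, x v = 0 ∨ x v = 1) :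
    x = charVec {v | x v = 1} := by
  funext v
  rcases hx v with h | h <;> simp [charVec, h]

theorem isKTRegular_iff_mulVec_charVec {V : Type*} [Fintype V] [DecidableEq V]
    (G : SimpleGraph V) [DecidableRel G.Adj] (S : Set V) (κ τ : ℕ) :
    IsKTRegular G S κ τ ↔
      (G.adjMatrix ℝ - ((κ : ℝ) - τ) • (1 : Matrix V V ℝ)) *ᵥ charVec S =
        (τ : ℝ) • (1 : V → ℝ) := by
  have hS (v : V) (hv : v ∈ S) : charVec S v = 1 := by simp [charVec, hv]
  have hS' (v : V) (hv : v ∉ S) : charVec S v = 0 := by simp [charVec, hv]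
  simp only [funext_iff, sub_mulVec, smul_mulVec, one_mulVec, Pi.sub_apply, Pi.smul_apply,
    Pi.one_apply, smul_eq_mul, mul_one, adjMatrix_mulVec_charVec]
  constructor
  · rintro ⟨hin, hout⟩ v
    by_cases hv : v ∈ S
    · rw [hin v hv, hS v hv]
      ring
    · rw [hout v hv, hS' v hv]
      ring
  · refine fun h => ⟨fun v hv => ?_, fun v hv => ?_⟩ <;> have hv' := h v
    · rw [hS v hv] at hv'
      exact_mod_cast (by linarith : ((G.neighborSet v ∩ S).ncard : ℝ) = κ)
    · rw [hS' v hv] at hv'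
      exact_mod_cast (by linarith : ((G.neighborSet v ∩ S).ncard : ℝ) = τ)

/-- A graph has a `(κ,τ)`-regular set iff the linear system `(A_G - (κ-τ)I)x = τ𝟙` has a 0-1
solution; moreover every 0-1 solution is the characteristic vector of a `(κ,τ)`-regular set. -/
theorem kt_regular_iff_linear_system {n κ τ : ℕ} (G : SimpleGraph (Fin n))
    [DecidableRel G.Adj] :
    ((∃ S : Set (Fin n), IsKTRegular G S κ τ) ↔
      ∃ x : Fin n → ℝ, (∀ i, x i = 0 ∨ x i = 1) ∧
        (G.adjMatrix ℝ - ((κ : ℝ) - τ) • (1 : Matrix (Fin n) (Fin n) ℝ)).mulVec x =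
          (τ : ℝ) • (1 : Fin n → ℝ)) ∧
    ∀ x : Fin n → ℝ, (∀ i, x i = 0 ∨ x i = 1) →
      (G.adjMatrix ℝ - ((κ : ℝ) - τ) • (1 : Matrix (Fin n) (Fin n) ℝ)).mulVec x =
        (τ : ℝ) • (1 : Fin n → ℝ) →
      ∃ S : Set (Fin n), IsKTRegular G S κ τ ∧ x = charVec S := by
  have hsol : ∀ x : Fin n → ℝ, (∀ i, x i = 0 ∨ x i = 1) →
      (G.adjMatrix ℝ - ((κ : ℝ) - τ) • (1 : Matrix (Fin n) (Fin n) ℝ)).mulVec x =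
        (τ : ℝ) • (1 : Fin n → ℝ) →
      ∃ S : Set (Fin n), IsKTRegular G S κ τ ∧ x = charVec S := by
    intro x hx h
    have hxS := eq_charVec_of_zero_or_one hx
    refine ⟨{i | x i = 1}, ?_, hxS⟩
    rwa [isKTRegular_iff_mulVec_charVec, ← hxS]
  refine ⟨⟨?_, ?_⟩, hsol⟩
  · rintro ⟨S, hS⟩
    exact ⟨charVec S, charVec_eq_zero_or_one S, (isKTRegular_iff_mulVec_charVec G S κ τ).1 hS⟩
  · rintro ⟨x, hx, h⟩
    obtain ⟨S, hS, -⟩ := hsol x hx h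
    exact ⟨S, hS⟩
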